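/- For every set of processes ρ and networks N, N' with N →^{τ_P}_{D'} N', if P ∩ ρ = ∅ then N ∖ ρ →^{τ_P}_{D'} N' ∖ ρ, where N ∖ ρ is the network obtained by removing from N all processes in ρ. -/

import Mathlib

namespace ChorLam

/-! ### Basic names -/

abbrev Proc := ℕ
abbrev TVar := ℕ
abbrev Var := ℕ
abbrev FName := ℕ
abbrev Label := String

/-- A "process value": a type value of process kind, i.e. either
a type variable or a process name.  These populate the process-name sets ρ. -/
inductive PV where
  | var (X : TVar)
  | proc (p : Proc)
deriving DecidableEq

/-! ### Kinds -/

/-- Kinds of Chorλ∀: `∗`, `K₁ ⇒ K₂`, the kind `⊙` of process names,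
and restricted kinds `K\ρ`. -/
inductive Kind where
  | star
  | arrow (K1 K2 : Kind)
  | proc
  | without (K : Kind) (ρ : Finset PV)
deriving DecidableEq

/-- A kind is a process kind if it is `⊙` or a restriction of `⊙`. -/
def Kind.isProcKind (K : Kind) : Prop :=
  K = .proc ∨ ∃ ρ : Finset PV, K = .without .proc ρ

/-! ### Choreographic types -/

/-- Types of Chorλ∀. -/
inductive CType where
  | var (X : TVar)
  | unit (V : CType)                              -- ()@V
  | int (V : CType)                               -- Int@V
  | arrow (T1 : CType) (ρ : Finset PV) (T2 : CType)  -- T1 →ρ T2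
  | sum (T1 T2 : CType)
  | prod (T1 T2 : CType)
  | all (X : TVar) (K : Kind) (T : CType)         -- ∀X::K.T
  | lam (X : TVar) (K : Kind) (T : CType)         -- ΛX::K.T
  | app (T1 T2 : CType)
  | proc (p : Proc)
deriving DecidableEq

/-- Type values: types containing no type applications. -/
def CType.isValue : CType → Prop
  | .var _ => True
  | .proc _ => True
  | .unit V => V.isValue
  | .int V => V.isValue
  | .arrow T1 _ T2 => T1.isValue ∧ T2.isValue
  | .sum T1 T2 => T1.isValue ∧ T2.isValue
  | .prod T1 T2 => T1.isValue ∧ T2.isValue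
  | .all _ _ T => T.isValue
  | .lam _ _ T => T.isValue
  | .app _ _ => False

/-- Free type variables of a process value. -/
def PV.ftv : PV → Finset TVar
  | .var X => {X}
  | .proc _ => ∅

/-- Free type variables of a process-name set. -/
def pvsFtv (ρ : Finset PV) : Finset TVar := ρ.biUnion PV.ftv

/-- Free type variables of a type (standard; `∀X::K.T` and `ΛX::K.T` bind `X`). -/
def CType.ftv : CType → Finset TVar
  | .var X => {X}
  | .proc _ => ∅
  | .unit V => V.ftv
  | .int V => V.ftv
  | .arrow T1 ρ T2 => T1.ftv ∪ T2.ftv ∪ pvsFtv ρ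
  | .sum T1 T2 => T1.ftv ∪ T2.ftv
  | .prod T1 T2 => T1.ftv ∪ T2.ftv
  | .all X _ T => T.ftv.erase X
  | .lam X _ T => T.ftv.erase X
  | .app T1 T2 => T1.ftv ∪ T2.ftv

/-- Involved processes of a type (`roles`). -/
def CType.roles : CType → Set Proc
  | .var _ => ∅
  | .proc p => {p}
  | .unit V => V.roles
  | .int V => V.roles
  | .arrow T1 ρ T2 => T1.roles ∪ T2.roles ∪ {p | PV.proc p ∈ ρ}
  | .sum T1 T2 => T1.roles ∪ T2.roles
  | .prod T1 T2 => T1.roles ∪ T2.roles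
  | .all _ (.without _ ρ) T => T.roles ∪ {p | PV.proc p ∉ ρ}
  | .all _ _ _ => Set.univ
  | .lam _ (.without _ ρ) T => T.roles ∪ {p | PV.proc p ∉ ρ}
  | .lam _ _ _ => Set.univ
  | .app T1 T2 => T1.roles ∪ T2.roles

/-- Mentioned processes of a type (`mn`), as a set of process values. -/
def CType.mn : CType → Finset PV
  | .var _ => ∅
  | .proc p => {PV.proc p}
  | .unit V => V.mn
  | .int V => V.mn
  | .arrow T1 ρ T2 => T1.mn ∪ T2.mn ∪ ρ
  | .sum T1 T2 => T1.mn ∪ T2.mn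
  | .prod T1 T2 => T1.mn ∪ T2.mn
  | .all _ (.without _ ρ) T => T.mn ∪ ρ
  | .all _ _ T => T.mn
  | .lam _ (.without _ ρ) T => T.mn ∪ ρ
  | .lam _ _ T => T.mn
  | .app T1 T2 => T1.mn ∪ T2.mn

/-- The involved processes and free type variables of a type, as process values. -/
def CType.pvs (T : CType) : Set PV :=
  (PV.proc '' T.roles) ∪ (PV.var '' (↑T.ftv : Set TVar))

/-- All process names literally occurring in a kind. -/
def Kind.procs : Kind → Set Proc
  | .star => ∅
  | .proc => ∅
  | .arrow K1 K2 => K1.procs ∪ K2.procs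
  | .without K ρ => K.procs ∪ {p | PV.proc p ∈ ρ}

/-- All process names literally occurring in a type. -/
def CType.procs : CType → Set Proc
  | .var _ => ∅
  | .proc p => {p}
  | .unit V => V.procs
  | .int V => V.procs
  | .arrow T1 ρ T2 => T1.procs ∪ T2.procs ∪ {p | PV.proc p ∈ ρ}
  | .sum T1 T2 => T1.procs ∪ T2.procs
  | .prod T1 T2 => T1.procs ∪ T2.procs
  | .all _ K T => K.procs ∪ T.procs
  | .lam _ K T => K.procs ∪ T.procs
  | .app T1 T2 => T1.procs ∪ T2.procs

/-! ### Substitution on types -/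

/-- Substitution of a type for a type variable inside a process value. -/
def PV.subst (X : TVar) (S : CType) : PV → PV
  | .var Y =>
      if Y = X then
        match S with
        | .proc p => .proc p
        | .var Z => .var Z
        | _ => .var Y
      else .var Y
  | .proc p => .proc p

def Kind.subst (X : TVar) (S : CType) : Kind → Kind
  | .star => .star
  | .arrow K1 K2 => .arrow (K1.subst X S) (K2.subst X S)
  | .proc => .proc
  | .without K ρ => .without (K.subst X S) (ρ.image (PV.subst X S))

/-- (Naive) substitution `T[X := S]` on types. -/
def CType.subst (X : TVar) (S : CType) : CType → CType
  | .var Y => if Y = X then S else .var Y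
  | .proc p => .proc p
  | .unit V => .unit (CType.subst X S V)
  | .int V => .int (CType.subst X S V)
  | .arrow T1 ρ T2 =>
      .arrow (CType.subst X S T1) (ρ.image (PV.subst X S)) (CType.subst X S T2)
  | .sum T1 T2 => .sum (CType.subst X S T1) (CType.subst X S T2)
  | .prod T1 T2 => .prod (CType.subst X S T1) (CType.subst X S T2)
  | .all Y K T =>
      if Y = X then .all Y (K.subst X S) T
      else .all Y (K.subst X S) (CType.subst X S T)
  | .lam Y K T =>
      if Y = X then .lam Y (K.subst X S) T
      else .lam Y (K.subst X S) (CType.subst X S T)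
  | .app T1 T2 => .app (CType.subst X S T1) (CType.subst X S T2)

/-- Renaming of a process name `p` to `q` in a process value. -/
def PV.psubst (p q : Proc) : PV → PV
  | .var X => .var X
  | .proc r => if r = p then .proc q else .proc r

def Kind.psubst (p q : Proc) : Kind → Kind
  | .star => .star
  | .arrow K1 K2 => .arrow (K1.psubst p q) (K2.psubst p q)
  | .proc => .proc
  | .without K ρ => .without (K.psubst p q) (ρ.image (PV.psubst p q))

/-- Renaming of a process name `p` to `q` in a type: `T[p := q]`. -/
def CType.psubst (p q : Proc) : CType → CType
  | .var X => .var X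
  | .proc r => if r = p then .proc q else .proc r
  | .unit V => .unit (V.psubst p q)
  | .int V => .int (V.psubst p q)
  | .arrow T1 ρ T2 => .arrow (T1.psubst p q) (ρ.image (PV.psubst p q)) (T2.psubst p q)
  | .sum T1 T2 => .sum (T1.psubst p q) (T2.psubst p q)
  | .prod T1 T2 => .prod (T1.psubst p q) (T2.psubst p q)
  | .all X K T => .all X (K.psubst p q) (T.psubst p q)
  | .lam X K T => .lam X (K.psubst p q) (T.psubst p q)
  | .app T1 T2 => .app (T1.psubst p q) (T2.psubst p q)

/-! ### Type equivalence -/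

/-- Type equivalence `T ≡ T'`: the reflexive, symmetric, transitive, congruent
closure of β-reduction of type-level applications. -/
inductive TEquiv : CType → CType → Prop
  | refl (T : CType) : TEquiv T T
  | symm : TEquiv T1 T2 → TEquiv T2 T1
  | trans : TEquiv T1 T2 → TEquiv T2 T3 → TEquiv T1 T3
  | arrow : TEquiv T1 T1' → TEquiv T2 T2' → TEquiv (.arrow T1 ρ T2) (.arrow T1' ρ T2')
  | sum : TEquiv T1 T1' → TEquiv T2 T2' → TEquiv (.sum T1 T2) (.sum T1' T2')
  | prod : TEquiv T1 T1' → TEquiv T2 T2' → TEquiv (.prod T1 T2) (.prod T1' T2')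
  | lam : TEquiv T T' → TEquiv (.lam X K T) (.lam X K T')
  | all : TEquiv T T' → TEquiv (.all X K T) (.all X K T')
  | app : TEquiv T1 T1' → TEquiv T2 T2' → TEquiv (.app T1 T2) (.app T1' T2')
  | beta : TEquiv (.app (.lam X K T1) T2) (T1.subst X T2)

/-! ### Subkinding -/

inductive Subkind : Kind → Kind → Prop
  | refl (K : Kind) : Subkind K K
  | trans : Subkind K1 K2 → Subkind K2 K3 → Subkind K1 K3
  | arrow : Subkind K1 K1' → Subkind K2 K2' → Subkind (.arrow K1 K2) (.arrow K1' K2')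
  | empty (K : Kind) : Subkind K (.without K ∅)
  | withoutL : Subkind K1 K2 → Subkind (.without K1 ρ) K2
  | withoutUnion : Subkind K1 K2 → Subkind (.without K1 (ρ1 ∪ ρ2)) (.without K2 ρ1)

end ChorLam
/-! ### Typing contexts -/

namespace ChorLam

/-- Entries of the typing environment Γ: term variables and function names
with their types, and type variables / process names with their kinds. -/
inductive CtxEntry where
  | tv (x : Var) (T : CType)
  | fv (f : FName) (T : CType)
  | kd (v : PV) (K : Kind)
deriving DecidableEq

abbrev Ctx := List CtxEntry

/-- `K + X`: remove `X` from all restrictions in `K`. -/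
def Kind.plus (X : TVar) : Kind → Kind
  | .star => .star
  | .arrow K1 K2 => .arrow (K1.plus X) (K2.plus X)
  | .proc => .proc
  | .without K ρ => .without (K.plus X) (ρ.erase (PV.var X))

/-- `Γ + X`: remove `X` from all restrictions in kinds recorded in Γ. -/
def Ctx.plus (X : TVar) (Γ : Ctx) : Ctx :=
  Γ.map fun e =>
    match e with
    | .kd v K => .kd v (K.plus X)
    | e => e

/-- Add the restriction `X` to a kind. -/
def Kind.addRestr (X : TVar) : Kind → Kind
  | .without K ρ => .without K (insert (PV.var X) ρ)
  | K => .without K {PV.var X}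

/-- `Γ & ρ X`: add the restriction `X` to the kind of every type value in ρ. -/
def Ctx.addkind (ρ : Finset PV) (X : TVar) (Γ : Ctx) : Ctx :=
  Γ.map fun e =>
    match e with
    | .kd v K => if v ∈ ρ then .kd v (K.addRestr X) else .kd v K
    | e => e

/-- The context Γ' used for typing the body of a type abstraction `ΛX::K.M`. -/
def ctxExt (Γ : Ctx) (X : TVar) (K : Kind) : Ctx :=
  match K with
  | .without _ ρ => Ctx.addkind ρ X (Ctx.plus X Γ)
  | _ => Ctx.plus X Γ

/-- The process context Θ' used when binding a type variable `X` of kind `K`. -/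
def thetaExt (Θ : Set PV) (X : TVar) (K : Kind) : Set PV :=
  Θ ∪ {v | v = PV.var X ∧ K.isProcKind}

/-- The canonical type of a process value. -/
def PV.toType : PV → CType
  | .var X => .var X
  | .proc p => .proc p

/-! ### Kinding -/

/-- The kinding judgment `Θ;Γ ⊢ T :: K`. -/
inductive Kinding : Set PV → Ctx → CType → Kind → Prop
  | kvar :
      CtxEntry.kd (.var X) K ∈ Γ →
      (K.isProcKind → PV.var X ∈ Θ) →
      Kinding Θ Γ (.var X) K
  | krole :
      CtxEntry.kd (.proc p) K ∈ Γ →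
      K.isProcKind →
      PV.proc p ∈ Θ →
      (∀ ρ, K = .without .proc ρ → PV.proc p ∉ ρ) →
      Kinding Θ Γ (.proc p) K
  | kunit :
      Kinding Θ Γ T (.without .proc ρ) →
      Kinding Θ Γ (.unit T) (.without .star ρ)
  | kint :
      Kinding Θ Γ T (.without .proc ρ) →
      Kinding Θ Γ (.int T) (.without .star ρ)
  | kfun :
      Kinding Θ Γ T1 (.without .star ρ2) →
      Kinding Θ Γ T2 (.without .star ρ2) →
      (∀ v ∈ ρ1, Kinding Θ Γ v.toType (.without .proc ρ2)) →
      Kinding Θ Γ (.arrow T1 ρ1 T2) (.without .star ρ2)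
  | kabs :
      Kinding (thetaExt Θ X K1) (CtxEntry.kd (.var X) K1 :: Γ) T K2 →
      Kinding Θ Γ (.lam X K1 T) (.arrow K1 K2)
  | kall :
      Kinding (thetaExt Θ X K) (CtxEntry.kd (.var X) K :: Γ) T (.without .star ρ) →
      Kinding Θ Γ (.all X K T) (.without .star ρ)
  | kapp :
      Kinding Θ Γ T1 (.arrow K1 K2) →
      Kinding Θ Γ T2 K1 →
      Kinding Θ Γ (.app T1 T2) K2
  | karr :
      Kinding Θ Γ T (.arrow (.without K1 ρ) (.without K2 ρ)) →
      Kinding Θ Γ T (.without (.arrow K1 K2) ρ)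
  | ksub :
      Kinding Θ Γ T K1 →
      Subkind K1 K2 →
      Kinding Θ Γ T K2
  | ksum :
      Kinding Θ Γ T1 (.without .star ρ) →
      Kinding Θ Γ T2 (.without .star ρ) →
      Kinding Θ Γ (.sum T1 T2) (.without .star ρ)
  | kprod :
      Kinding Θ Γ T1 (.without .star ρ) →
      Kinding Θ Γ T2 (.without .star ρ) →
      Kinding Θ Γ (.prod T1 T2) (.without .star ρ)

end ChorLam
namespace ChorLam

/-! ### Choreographies -/

/-- Choreography expressions of Chorλ∀. -/
inductive Chor where
  | var (x : Var)
  | unit (V : CType)                         -- ()@V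
  | int (n : ℤ) (V : CType)                  -- n@V
  | lam (x : Var) (T : CType) (M : Chor)     -- λx:T.M
  | tlam (X : TVar) (K : Kind) (M : Chor)    -- ΛX::K.M
  | app (M N : Chor)
  | tapp (M : Chor) (T : CType)
  | inl (T : CType) (M : Chor)
  | inr (T : CType) (M : Chor)
  | case (M : Chor) (x : Var) (N1 : Chor) (y : Var) (N2 : Chor)
  | pair (M N : Chor)
  | fst (M : Chor)
  | snd (M : Chor)
  | com (T : CType) (V1 V2 : CType)          -- com_T from V1 to V2
  | select (V1 V2 : CType) (l : Label) (M : Chor)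
  | fn (f : FName)
deriving DecidableEq

/-- Values of Chorλ∀. -/
def Chor.isValue : Chor → Prop
  | .var _ => True
  | .unit _ => True
  | .int _ _ => True
  | .lam _ _ _ => True
  | .tlam _ _ _ => True
  | .com _ _ _ => True
  | .inl _ M => M.isValue
  | .inr _ M => M.isValue
  | .pair M N => M.isValue ∧ N.isValue
  | _ => False

/-- Free term variables of a choreography. -/
def Chor.fv : Chor → Set Var
  | .var x => {x}
  | .unit _ => ∅
  | .int _ _ => ∅
  | .lam x _ M => M.fv \ {x}
  | .tlam _ _ M => M.fv
  | .app M N => M.fv ∪ N.fv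
  | .tapp M _ => M.fv
  | .inl _ M => M.fv
  | .inr _ M => M.fv
  | .case M x N1 y N2 => M.fv ∪ (N1.fv \ {x}) ∪ (N2.fv \ {y})
  | .pair M N => M.fv ∪ N.fv
  | .fst M => M.fv
  | .snd M => M.fv
  | .com _ _ _ => ∅
  | .select _ _ _ M => M.fv
  | .fn _ => ∅

/-- Free type variables of a choreography. -/
def Chor.ftv : Chor → Set TVar
  | .var _ => ∅
  | .unit V => ↑V.ftv
  | .int _ V => ↑V.ftv
  | .lam _ T M => ↑T.ftv ∪ M.ftv
  | .tlam X _ M => M.ftv \ {X}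
  | .app M N => M.ftv ∪ N.ftv
  | .tapp M T => M.ftv ∪ ↑T.ftv
  | .inl T M => ↑T.ftv ∪ M.ftv
  | .inr T M => ↑T.ftv ∪ M.ftv
  | .case M _ N1 _ N2 => M.ftv ∪ N1.ftv ∪ N2.ftv
  | .pair M N => M.ftv ∪ N.ftv
  | .fst M => M.ftv
  | .snd M => M.ftv
  | .com T V1 V2 => ↑T.ftv ∪ ↑V1.ftv ∪ ↑V2.ftv
  | .select V1 V2 _ M => ↑V1.ftv ∪ ↑V2.ftv ∪ M.ftv
  | .fn _ => ∅

/-- A choreography is closed if it has no free term or type variables. -/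
def Chor.closed (M : Chor) : Prop := M.fv = ∅ ∧ M.ftv = ∅

/-- Function names occurring in a choreography. -/
def Chor.fns : Chor → Set FName
  | .var _ => ∅
  | .unit _ => ∅
  | .int _ _ => ∅
  | .lam _ _ M => M.fns
  | .tlam _ _ M => M.fns
  | .app M N => M.fns ∪ N.fns
  | .tapp M _ => M.fns
  | .inl _ M => M.fns
  | .inr _ M => M.fns
  | .case M _ N1 _ N2 => M.fns ∪ N1.fns ∪ N2.fns
  | .pair M N => M.fns ∪ N.fns
  | .fst M => M.fns
  | .snd M => M.fns
  | .com _ _ _ => ∅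
  | .select _ _ _ M => M.fns
  | .fn f => {f}

/-- Process names occurring in a choreography (its roles). -/
def Chor.procs : Chor → Set Proc
  | .var _ => ∅
  | .unit V => V.procs
  | .int _ V => V.procs
  | .lam _ T M => T.procs ∪ M.procs
  | .tlam _ K M => K.procs ∪ M.procs
  | .app M N => M.procs ∪ N.procs
  | .tapp M T => M.procs ∪ T.procs
  | .inl T M => T.procs ∪ M.procs
  | .inr T M => T.procs ∪ M.procs
  | .case M _ N1 _ N2 => M.procs ∪ N1.procs ∪ N2.procs
  | .pair M N => M.procs ∪ N.procs
  | .fst M => M.procs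
  | .snd M => M.procs
  | .com T V1 V2 => T.procs ∪ V1.procs ∪ V2.procs
  | .select V1 V2 _ M => V1.procs ∪ V2.procs ∪ M.procs
  | .fn _ => ∅

/-- (Naive) substitution of a choreography for a term variable: `M[x := N]`. -/
def Chor.subst (x : Var) (N : Chor) : Chor → Chor
  | .var y => if y = x then N else .var y
  | .unit V => .unit V
  | .int n V => .int n V
  | .lam y T M =>
      if y = x then .lam y T M else .lam y T (Chor.subst x N M)
  | .tlam X K M => .tlam X K (Chor.subst x N M)
  | .app M1 M2 => .app (Chor.subst x N M1) (Chor.subst x N M2)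
  | .tapp M T => .tapp (Chor.subst x N M) T
  | .inl T M => .inl T (Chor.subst x N M)
  | .inr T M => .inr T (Chor.subst x N M)
  | .case M y N1 z N2 =>
      .case (Chor.subst x N M) y (if y = x then N1 else Chor.subst x N N1)
        z (if z = x then N2 else Chor.subst x N N2)
  | .pair M1 M2 => .pair (Chor.subst x N M1) (Chor.subst x N M2)
  | .fst M => .fst (Chor.subst x N M)
  | .snd M => .snd (Chor.subst x N M)
  | .com T V1 V2 => .com T V1 V2
  | .select V1 V2 l M => .select V1 V2 l (Chor.subst x N M)
  | .fn f => .fn f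

/-- Substitution of a type for a type variable in a choreography: `M[X := S]`. -/
def Chor.substT (X : TVar) (S : CType) : Chor → Chor
  | .var y => .var y
  | .unit V => .unit (CType.subst X S V)
  | .int n V => .int n (CType.subst X S V)
  | .lam y T M => .lam y (CType.subst X S T) (Chor.substT X S M)
  | .tlam Y K M =>
      if Y = X then .tlam Y (K.subst X S) M
      else .tlam Y (K.subst X S) (Chor.substT X S M)
  | .app M1 M2 => .app (Chor.substT X S M1) (Chor.substT X S M2)
  | .tapp M T => .tapp (Chor.substT X S M) (CType.subst X S T)
  | .inl T M => .inl (CType.subst X S T) (Chor.substT X S M)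
  | .inr T M => .inr (CType.subst X S T) (Chor.substT X S M)
  | .case M y N1 z N2 =>
      .case (Chor.substT X S M) y (Chor.substT X S N1) z (Chor.substT X S N2)
  | .pair M1 M2 => .pair (Chor.substT X S M1) (Chor.substT X S M2)
  | .fst M => .fst (Chor.substT X S M)
  | .snd M => .snd (Chor.substT X S M)
  | .com T V1 V2 => .com (CType.subst X S T) (CType.subst X S V1) (CType.subst X S V2)
  | .select V1 V2 l M =>
      .select (CType.subst X S V1) (CType.subst X S V2) l (Chor.substT X S M)
  | .fn f => .fn f

/-- Renaming of a process name `p` to `q` in a choreography: `M[p := q]`. -/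
def Chor.psubst (p q : Proc) : Chor → Chor
  | .var y => .var y
  | .unit V => .unit (V.psubst p q)
  | .int n V => .int n (V.psubst p q)
  | .lam y T M => .lam y (T.psubst p q) (Chor.psubst p q M)
  | .tlam X K M => .tlam X (K.psubst p q) (Chor.psubst p q M)
  | .app M1 M2 => .app (Chor.psubst p q M1) (Chor.psubst p q M2)
  | .tapp M T => .tapp (Chor.psubst p q M) (T.psubst p q)
  | .inl T M => .inl (T.psubst p q) (Chor.psubst p q M)
  | .inr T M => .inr (T.psubst p q) (Chor.psubst p q M)
  | .case M y N1 z N2 =>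
      .case (Chor.psubst p q M) y (Chor.psubst p q N1) z (Chor.psubst p q N2)
  | .pair M1 M2 => .pair (Chor.psubst p q M1) (Chor.psubst p q M2)
  | .fst M => .fst (Chor.psubst p q M)
  | .snd M => .snd (Chor.psubst p q M)
  | .com T V1 V2 => .com (T.psubst p q) (V1.psubst p q) (V2.psubst p q)
  | .select V1 V2 l M =>
      .select (V1.psubst p q) (V2.psubst p q) l (Chor.psubst p q M)
  | .fn f => .fn f

/-! ### Typing of choreographies -/

/-- The typing judgment `Θ;Γ ⊢ M : T`. -/
inductive Typing : Set PV → Ctx → Chor → CType → Prop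
  | tunit :
      Kinding Θ Γ V .proc →
      Typing Θ Γ (.unit V) (.unit V)
  | tint :
      Kinding Θ Γ V .proc →
      Typing Θ Γ (.int n V) (.int V)
  | tvar :
      CtxEntry.tv x T ∈ Γ →
      Typing Θ Γ (.var x) T
  | tfun :
      CtxEntry.fv f T ∈ Γ →
      Typing Θ Γ (.fn f) T
  | tapp :
      Typing Θ Γ N (.arrow T1 ρ T2) →
      Typing Θ Γ M T1 →
      Typing Θ Γ (.app N M) T2
  | tabs {ρ : Finset PV} :
      Kinding Θ Γ T1 .star →
      (∀ v ∈ ρ, Kinding Θ Γ v.toType .proc) →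
      Typing (Θ ∩ (↑ρ ∪ T1.pvs ∪ T2.pvs)) (CtxEntry.tv x T1 :: Γ) M T2 →
      Typing Θ Γ (.lam x T1 M) (.arrow T1 ρ T2)
  | tsel :
      Kinding Θ Γ V1 .proc →
      Kinding Θ Γ V2 .proc →
      Typing Θ Γ M T →
      Typing Θ Γ (.select V1 V2 l M) T
  | tcom :
      Kinding Θ Γ T (.arrow .proc .star) →
      Kinding Θ Γ V1 (.without .proc (T.mn ∪ T.ftv.image PV.var)) →
      Kinding Θ Γ V2 (.without .proc (T.mn ∪ T.ftv.image PV.var)) →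
      Typing Θ Γ (.com T V1 V2) (.arrow (.app T V1) ∅ (.app T V2))
  | tappT :
      Typing Θ Γ M (.all X K T1) →
      Kinding Θ Γ T2 K →
      Typing Θ Γ (.tapp M T2) (CType.subst X T2 T1)
  | tabsT :
      Typing (thetaExt Θ X K) (CtxEntry.kd (.var X) K :: ctxExt Γ X K) M T →
      Typing Θ Γ (.tlam X K M) (.all X K T)
  | teq :
      Typing Θ Γ M T1 →
      TEquiv T1 T2 →
      Kinding Θ Γ T2 .star →
      Typing Θ Γ M T2
  | tcase :
      Typing Θ Γ N (.sum T1 T2) →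
      Typing Θ (CtxEntry.tv x T1 :: Γ) M1 T →
      Typing Θ (CtxEntry.tv y T2 :: Γ) M2 T →
      Typing Θ Γ (.case N x M1 y M2) T
  | tpair :
      Typing Θ Γ M T1 →
      Typing Θ Γ N T2 →
      Typing Θ Γ (.pair M N) (.prod T1 T2)
  | tproj1 :
      Typing Θ Γ M (.prod T1 T2) →
      Typing Θ Γ (.fst M) T1
  | tproj2 :
      Typing Θ Γ M (.prod T1 T2) →
      Typing Θ Γ (.snd M) T2
  | tinl :
      Typing Θ Γ M T1 →
      Typing Θ Γ (.inl T2 M) (.sum T1 T2)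
  | tinr :
      Typing Θ Γ M T2 →
      Typing Θ Γ (.inr T1 M) (.sum T1 T2)

/-- Well-typedness of a set of function definitions: `Θ;Γ ⊢ D`. -/
def DefsTyping (Γ : Ctx) (D : FName → Option Chor) : Prop :=
  ∀ f M, D f = some M → ∃ T, CtxEntry.fv f T ∈ Γ ∧ Typing ∅ Γ M T

/-! ### Operational semantics of choreographies -/

/-- The call-by-value reduction relation `M →_D M'` of choreographies. -/
inductive Step (D : FName → Option Chor) : Chor → Chor → Prop
  | appAbs :
      V.isValue →
      Step D (.app (.lam x T M) V) (Chor.subst x V M)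
  | app1 :
      Step D M1 M2 →
      Step D (.app M1 N) (.app M2 N)
  | app2 :
      V.isValue →
      Step D N1 N2 →
      Step D (.app V N1) (.app V N2)
  | appTAbs :
      TEquiv T V →
      CType.isValue V →
      Step D (.tapp (.tlam X K M) T) (Chor.substT X V M)
  | tapp1 :
      Step D M1 M2 →
      Step D (.tapp M1 T) (.tapp M2 T)
  | inl :
      Step D M1 M2 →
      Step D (.inl T M1) (.inl T M2)
  | inr :
      Step D M1 M2 →
      Step D (.inr T M1) (.inr T M2)
  | case :
      Step D N1 N2 →
      Step D (.case N1 x M1 y M2) (.case N2 x M1 y M2)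
  | caseL :
      V.isValue →
      Step D (.case (.inl T V) x M1 y M2) (Chor.subst x V M1)
  | caseR :
      V.isValue →
      Step D (.case (.inr T V) x M1 y M2) (Chor.subst y V M2)
  | pair1 :
      Step D M1 M2 →
      Step D (.pair M1 N) (.pair M2 N)
  | pair2 :
      V.isValue →
      Step D N1 N2 →
      Step D (.pair V N1) (.pair V N2)
  | fst :
      Step D M1 M2 →
      Step D (.fst M1) (.fst M2)
  | snd :
      Step D M1 M2 →
      Step D (.snd M1) (.snd M2)
  | proj1 :
      V1.isValue → V2.isValue →
      Step D (.fst (.pair V1 V2)) V1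
  | proj2 :
      V1.isValue → V2.isValue →
      Step D (.snd (.pair V1 V2)) V2
  | defn :
      D f = some M →
      Step D (.fn f) M
  | sel :
      Step D (.select (.proc p) (.proc q) l M) M
  | com :
      V.isValue →
      Step D (.app (.com T (.proc p) (.proc q)) V) (Chor.psubst p q V)

end ChorLam
namespace ChorLam

/-! ### The local (network) language -/

/-- Local types of the network language. -/
inductive LType where
  | var (X : TVar)
  | unit
  | int
  | arrow (T1 T2 : LType)
  | proc (p : Proc)
  | bot                                -- ⊥, the undefined local type
  | sum (T1 T2 : LType)
  | prod (T1 T2 : LType)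
  | all (X : TVar) (T : LType)
  | lam (X : TVar) (T : LType)
  | app (T1 T2 : LType)
  | amI (V : LType) (T1 T2 : LType)    -- AmI_V(T1, T2)
deriving DecidableEq

/-- Local type values: local types with no type applications (and no AmI types). -/
def LType.isValue : LType → Prop
  | .var _ => True
  | .unit => True
  | .int => True
  | .proc _ => True
  | .bot => True
  | .arrow T1 T2 => T1.isValue ∧ T2.isValue
  | .sum T1 T2 => T1.isValue ∧ T2.isValue
  | .prod T1 T2 => T1.isValue ∧ T2.isValue
  | .all _ T => T.isValue
  | .lam _ T => T.isValue
  | .app _ _ => False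
  | .amI _ _ _ => False

/-- Substitution of a local type for a type variable. -/
def LType.subst (X : TVar) (S : LType) : LType → LType
  | .var Y => if Y = X then S else .var Y
  | .unit => .unit
  | .int => .int
  | .proc p => .proc p
  | .bot => .bot
  | .arrow T1 T2 => .arrow (LType.subst X S T1) (LType.subst X S T2)
  | .sum T1 T2 => .sum (LType.subst X S T1) (LType.subst X S T2)
  | .prod T1 T2 => .prod (LType.subst X S T1) (LType.subst X S T2)
  | .all Y T => if Y = X then .all Y T else .all Y (LType.subst X S T)
  | .lam Y T => if Y = X then .lam Y T else .lam Y (LType.subst X S T)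
  | .app T1 T2 => .app (LType.subst X S T1) (LType.subst X S T2)
  | .amI V T1 T2 => .amI (LType.subst X S V) (LType.subst X S T1) (LType.subst X S T2)

/-- Renaming of a process name `p` to `q` in a local type. -/
def LType.psubst (p q : Proc) : LType → LType
  | .var X => .var X
  | .unit => .unit
  | .int => .int
  | .proc r => if r = p then .proc q else .proc r
  | .bot => .bot
  | .arrow T1 T2 => .arrow (LType.psubst p q T1) (LType.psubst p q T2)
  | .sum T1 T2 => .sum (LType.psubst p q T1) (LType.psubst p q T2)
  | .prod T1 T2 => .prod (LType.psubst p q T1) (LType.psubst p q T2)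
  | .all Y T => .all Y (LType.psubst p q T)
  | .lam Y T => .lam Y (LType.psubst p q T)
  | .app T1 T2 => .app (LType.psubst p q T1) (LType.psubst p q T2)
  | .amI V T1 T2 => .amI (LType.psubst p q V) (LType.psubst p q T1) (LType.psubst p q T2)

/-- Local type equivalence `T ≡_p T'`, indexed by the process `p`:
β-equivalence of local types extended with the AmI rules. -/
inductive LTEquiv (p : Proc) : LType → LType → Prop
  | refl (T : LType) : LTEquiv p T T
  | symm : LTEquiv p T1 T2 → LTEquiv p T2 T1
  | trans : LTEquiv p T1 T2 → LTEquiv p T2 T3 → LTEquiv p T1 T3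
  | arrow : LTEquiv p T1 T1' → LTEquiv p T2 T2' → LTEquiv p (.arrow T1 T2) (.arrow T1' T2')
  | sum : LTEquiv p T1 T1' → LTEquiv p T2 T2' → LTEquiv p (.sum T1 T2) (.sum T1' T2')
  | prod : LTEquiv p T1 T1' → LTEquiv p T2 T2' → LTEquiv p (.prod T1 T2) (.prod T1' T2')
  | lam : LTEquiv p T T' → LTEquiv p (.lam X T) (.lam X T')
  | all : LTEquiv p T T' → LTEquiv p (.all X T) (.all X T')
  | app : LTEquiv p T1 T1' → LTEquiv p T2 T2' → LTEquiv p (.app T1 T2) (.app T1' T2')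
  | amI : LTEquiv p V V' → LTEquiv p T1 T1' → LTEquiv p T2 T2' →
      LTEquiv p (.amI V T1 T2) (.amI V' T1' T2')
  | beta : LTEquiv p (.app (.lam X T1) T2) (LType.subst X T2 T1)
  | iAm : LTEquiv p (.amI (.proc p) T1 T2) T1
  | iAmNot : q ≠ p → LTEquiv p (.amI (.proc q) T1 T2) T2

/-- Local programs of the network language.  In an offer term
`⊕V{ℓ : B_ℓ}`, the branches are given by a domain predicate on labels
together with a branch function. -/
inductive LTerm where
  | var (x : Var)
  | unit
  | int (n : ℤ)
  | bot                                         -- ⊥, the undefined local value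
  | lam (x : Var) (T : LType) (M : LTerm)
  | tlam (X : TVar) (M : LTerm)
  | app (M N : LTerm)
  | tapp (M : LTerm) (T : LType)
  | inl (T : LType) (M : LTerm)
  | inr (T : LType) (M : LTerm)
  | case (M : LTerm) (x : Var) (N1 : LTerm) (y : Var) (N2 : LTerm)
  | pair (M N : LTerm)
  | fst (M : LTerm)
  | snd (M : LTerm)
  | send (V : LType)                            -- send to V
  | recv (V : LType)                            -- receive from V
  | offer (V : LType) (dom : Label → Prop) (bs : Label → LTerm)  -- ⊕V{ℓ : bs ℓ}_{ℓ ∈ dom}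
  | choice (V : LType) (l : Label) (M : LTerm)  -- V ⊕ ℓ; M
  | sub (V1 V2 : LType)                         -- explicit substitution [V1 := V2]
  | fn (f : FName)
  | amI (V : LType) (M1 M2 : LTerm)             -- AmI V then M1 else M2

/-- Local values of the network language. -/
def LTerm.isValue : LTerm → Prop
  | .var _ => True
  | .unit => True
  | .int _ => True
  | .bot => True
  | .lam _ _ _ => True
  | .tlam _ _ => True
  | .send _ => True
  | .recv _ => True
  | .sub _ _ => True
  | .inl _ M => M.isValue
  | .inr _ M => M.isValue
  | .pair M N => M.isValue ∧ N.isValue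
  | _ => False

/-- Substitution of a local term for a term variable. -/
def LTerm.subst (x : Var) (N : LTerm) : LTerm → LTerm
  | .var y => if y = x then N else .var y
  | .unit => .unit
  | .int n => .int n
  | .bot => .bot
  | .lam y T M => if y = x then .lam y T M else .lam y T (LTerm.subst x N M)
  | .tlam X M => .tlam X (LTerm.subst x N M)
  | .app M1 M2 => .app (LTerm.subst x N M1) (LTerm.subst x N M2)
  | .tapp M T => .tapp (LTerm.subst x N M) T
  | .inl T M => .inl T (LTerm.subst x N M)
  | .inr T M => .inr T (LTerm.subst x N M)
  | .case M y N1 z N2 =>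
      .case (LTerm.subst x N M) y (if y = x then N1 else LTerm.subst x N N1)
        z (if z = x then N2 else LTerm.subst x N N2)
  | .pair M1 M2 => .pair (LTerm.subst x N M1) (LTerm.subst x N M2)
  | .fst M => .fst (LTerm.subst x N M)
  | .snd M => .snd (LTerm.subst x N M)
  | .send V => .send V
  | .recv V => .recv V
  | .offer V dom bs => .offer V dom (fun l => LTerm.subst x N (bs l))
  | .choice V l M => .choice V l (LTerm.subst x N M)
  | .sub V1 V2 => .sub V1 V2
  | .fn f => .fn f
  | .amI V M1 M2 => .amI V (LTerm.subst x N M1) (LTerm.subst x N M2)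

/-- Substitution of a local type for a type variable in a local term. -/
def LTerm.substT (X : TVar) (S : LType) : LTerm → LTerm
  | .var y => .var y
  | .unit => .unit
  | .int n => .int n
  | .bot => .bot
  | .lam y T M => .lam y (LType.subst X S T) (LTerm.substT X S M)
  | .tlam Y M => if Y = X then .tlam Y M else .tlam Y (LTerm.substT X S M)
  | .app M1 M2 => .app (LTerm.substT X S M1) (LTerm.substT X S M2)
  | .tapp M T => .tapp (LTerm.substT X S M) (LType.subst X S T)
  | .inl T M => .inl (LType.subst X S T) (LTerm.substT X S M)
  | .inr T M => .inr (LType.subst X S T) (LTerm.substT X S M)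
  | .case M y N1 z N2 =>
      .case (LTerm.substT X S M) y (LTerm.substT X S N1) z (LTerm.substT X S N2)
  | .pair M1 M2 => .pair (LTerm.substT X S M1) (LTerm.substT X S M2)
  | .fst M => .fst (LTerm.substT X S M)
  | .snd M => .snd (LTerm.substT X S M)
  | .send V => .send (LType.subst X S V)
  | .recv V => .recv (LType.subst X S V)
  | .offer V dom bs => .offer (LType.subst X S V) dom (fun l => LTerm.substT X S (bs l))
  | .choice V l M => .choice (LType.subst X S V) l (LTerm.substT X S M)
  | .sub V1 V2 => .sub (LType.subst X S V1) (LType.subst X S V2)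
  | .fn f => .fn f
  | .amI V M1 M2 => .amI (LType.subst X S V) (LTerm.substT X S M1) (LTerm.substT X S M2)

/-- Renaming of a process name `p` to `q` in a local term: `L[p := q]`. -/
def LTerm.psubst (p q : Proc) : LTerm → LTerm
  | .var y => .var y
  | .unit => .unit
  | .int n => .int n
  | .bot => .bot
  | .lam y T M => .lam y (LType.psubst p q T) (LTerm.psubst p q M)
  | .tlam Y M => .tlam Y (LTerm.psubst p q M)
  | .app M1 M2 => .app (LTerm.psubst p q M1) (LTerm.psubst p q M2)
  | .tapp M T => .tapp (LTerm.psubst p q M) (LType.psubst p q T)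
  | .inl T M => .inl (LType.psubst p q T) (LTerm.psubst p q M)
  | .inr T M => .inr (LType.psubst p q T) (LTerm.psubst p q M)
  | .case M y N1 z N2 =>
      .case (LTerm.psubst p q M) y (LTerm.psubst p q N1) z (LTerm.psubst p q N2)
  | .pair M1 M2 => .pair (LTerm.psubst p q M1) (LTerm.psubst p q M2)
  | .fst M => .fst (LTerm.psubst p q M)
  | .snd M => .snd (LTerm.psubst p q M)
  | .send V => .send (LType.psubst p q V)
  | .recv V => .recv (LType.psubst p q V)
  | .offer V dom bs => .offer (LType.psubst p q V) dom (fun l => LTerm.psubst p q (bs l))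
  | .choice V l M => .choice (LType.psubst p q V) l (LTerm.psubst p q M)
  | .sub V1 V2 => .sub (LType.psubst p q V1) (LType.psubst p q V2)
  | .fn f => .fn f
  | .amI V M1 M2 => .amI (LType.psubst p q V) (LTerm.psubst p q M1) (LTerm.psubst p q M2)

/-! ### Semantics of local programs -/

/-- Local transition labels. -/
inductive LLabel where
  | tau
  | proc (p : Proc)
  | send (p : Proc) (V V' : LTerm)
  | recv (p : Proc) (V' V : LTerm)
  | choice (p : Proc) (l : Label)
  | offer (p : Proc) (l : Label)

/-- The labelled transition system of local programs, `L →^μ_{D'} L'`. -/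
inductive LStep (D' : FName → Option LTerm) : LTerm → LLabel → LTerm → Prop
  | nsend :
      V.isValue → V'.isValue →
      LStep D' (.app (.send (.proc p)) V) (.send p V V') V'
  | nrecv :
      V.isValue → V'.isValue →
      LStep D' (.app (.recv (.proc p)) V) (.recv p V' V) V'
  | ncho :
      LStep D' (.choice (.proc p) l L) (.choice p l) L
  | noff :
      dom l →
      LStep D' (.offer (.proc p) dom bs) (.offer p l) (bs l)
  | namiR :
      LStep D' (.amI (.proc p) L1 L2) (.proc p) L1
  | namiL :
      q ≠ p →
      LStep D' (.amI (.proc p) L1 L2) (.proc q) L2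
  | nabsapp :
      V.isValue →
      LStep D' (.app (.lam x T M) V) .tau (LTerm.subst x V M)
  | nsub :
      V.isValue →
      LStep D' (.app (.sub (.proc p) (.proc q)) V) .tau (LTerm.psubst p q V)
  | nbabs :
      LTEquiv p T V →
      LType.isValue V →
      LStep D' (.tapp (.tlam X M) T) (.proc p) (LTerm.substT X V M)
  | napp1 :
      LStep D' M1 mu M2 →
      LStep D' (.app M1 N) mu (.app M2 N)
  | napp2 :
      V.isValue →
      LStep D' M1 mu M2 →
      LStep D' (.app V M1) mu (.app V M2)
  | ntapp1 :
      LStep D' M1 mu M2 →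
      LStep D' (.tapp M1 T) mu (.tapp M2 T)
  | ninl :
      LStep D' M1 mu M2 →
      LStep D' (.inl T M1) mu (.inl T M2)
  | ninr :
      LStep D' M1 mu M2 →
      LStep D' (.inr T M1) mu (.inr T M2)
  | ncase :
      LStep D' M1 mu M2 →
      LStep D' (.case M1 x N1 y N2) mu (.case M2 x N1 y N2)
  | ncaseL :
      V.isValue →
      LStep D' (.case (.inl T V) x N1 y N2) .tau (LTerm.subst x V N1)
  | ncaseR :
      V.isValue →
      LStep D' (.case (.inr T V) x N1 y N2) .tau (LTerm.subst y V N2)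
  | npair1 :
      LStep D' M1 mu M2 →
      LStep D' (.pair M1 N) mu (.pair M2 N)
  | npair2 :
      V.isValue →
      LStep D' M1 mu M2 →
      LStep D' (.pair V M1) mu (.pair V M2)
  | nfst :
      LStep D' M1 mu M2 →
      LStep D' (.fst M1) mu (.fst M2)
  | nsnd :
      LStep D' M1 mu M2 →
      LStep D' (.snd M1) mu (.snd M2)
  | nproj1 :
      V1.isValue → V2.isValue →
      LStep D' (.fst (.pair V1 V2)) .tau V1
  | nproj2 :
      V1.isValue → V2.isValue →
      LStep D' (.snd (.pair V1 V2)) .tau V2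
  | ndef :
      D' f = some L →
      LStep D' (.fn f) .tau L
  | nbot :
      LStep D' (.app .bot .bot) .tau .bot
  | nbott :
      LStep D' (.tapp .bot .bot) .tau .bot

/-! ### Networks -/

/-- A network maps each process to its local program (if it occurs in the network). -/
abbrev Network := Proc → Option LTerm

/-- Removing a set of processes from a network. -/
def Network.restrict (N : Network) (ρ : Finset Proc) : Network :=
  fun p => if p ∈ ρ then none else N p

/-- The labelled transition system of networks, `N →^{τ_P}_{D'} N'`,
where the label `P` records the processes involved in the transition. -/
inductive NetStep (D' : FName → Option LTerm) : Network → Finset Proc → Network → Prop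
  | ncom :
      q ≠ p →
      N q = some L1 → N p = some L2 →
      LTerm.isValue V → LTerm.isValue V' →
      LStep D' L1 (.send p V (LTerm.psubst q p V')) L1' →
      LStep D' L2 (.recv q (LTerm.psubst q p V) V') L2' →
      NetStep D' N {q, p} (Function.update (Function.update N q (some L1')) p (some L2'))
  | nsel :
      q ≠ p →
      N q = some L1 → N p = some L2 →
      LStep D' L1 (.choice p l) L1' →
      LStep D' L2 (.offer q l) L2' →
      NetStep D' N {q, p} (Function.update (Function.update N q (some L1')) p (some L2'))
  | nproam :
      N p = some L →
      LStep D' L (.proc p) L' →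
      NetStep D' N {p} (Function.update N p (some L'))
  | npro :
      N p = some L →
      LStep D' L .tau L' →
      NetStep D' N {p} (Function.update N p (some L'))

/-- One or more network transitions (with arbitrary labels). -/
def NetStepPlus (D' : FName → Option LTerm) : Network → Network → Prop :=
  Relation.TransGen (fun N N' => ∃ P, NetStep D' N P N')

/-- Zero or more network transitions (with arbitrary labels). -/
def NetStepStar (D' : FName → Option LTerm) : Network → Network → Prop :=
  Relation.ReflTransGen (fun N N' => ∃ P, NetStep D' N P N')

/-! ### Merging and the branching relation -/

/-- The (partial) merging operator `L ⊔ L' = L''` on local programs,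
presented as a relation: it unions the branches of offer terms with
the same sender and merges all other constructs homomorphically. -/
inductive LMerge : LTerm → LTerm → LTerm → Prop
  | offer :
      (∀ l, dom1 l → dom2 l → LMerge (bs1 l) (bs2 l) (bs l)) →
      (∀ l, dom1 l → ¬ dom2 l → bs l = bs1 l) →
      (∀ l, ¬ dom1 l → dom2 l → bs l = bs2 l) →
      LMerge (.offer V dom1 bs1) (.offer V dom2 bs2)
        (.offer V (fun l => dom1 l ∨ dom2 l) bs)
  | var : LMerge (.var x) (.var x) (.var x)
  | unit : LMerge .unit .unit .unit
  | int : LMerge (.int n) (.int n) (.int n)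
  | bot : LMerge .bot .bot .bot
  | lam : LMerge M M' M'' → LMerge (.lam x T M) (.lam x T M') (.lam x T M'')
  | tlam : LMerge M M' M'' → LMerge (.tlam X M) (.tlam X M') (.tlam X M'')
  | app :
      LMerge M1 M1' M1'' → LMerge M2 M2' M2'' →
      LMerge (.app M1 M2) (.app M1' M2') (.app M1'' M2'')
  | tapp : LMerge M M' M'' → LMerge (.tapp M T) (.tapp M' T) (.tapp M'' T)
  | inl : LMerge M M' M'' → LMerge (.inl T M) (.inl T M') (.inl T M'')
  | inr : LMerge M M' M'' → LMerge (.inr T M) (.inr T M') (.inr T M'')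
  | case :
      LMerge M M' M'' → LMerge N1 N1' N1'' → LMerge N2 N2' N2'' →
      LMerge (.case M x N1 y N2) (.case M' x N1' y N2') (.case M'' x N1'' y N2'')
  | pair :
      LMerge M1 M1' M1'' → LMerge M2 M2' M2'' →
      LMerge (.pair M1 M2) (.pair M1' M2') (.pair M1'' M2'')
  | fst : LMerge M M' M'' → LMerge (.fst M) (.fst M') (.fst M'')
  | snd : LMerge M M' M'' → LMerge (.snd M) (.snd M') (.snd M'')
  | send : LMerge (.send V) (.send V) (.send V)
  | recv : LMerge (.recv V) (.recv V) (.recv V)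
  | choice :
      LMerge M M' M'' →
      LMerge (.choice V l M) (.choice V l M') (.choice V l M'')
  | sub : LMerge (.sub V1 V2) (.sub V1 V2) (.sub V1 V2)
  | fn : LMerge (.fn f) (.fn f) (.fn f)
  | amI :
      LMerge M1 M1' M1'' → LMerge M2 M2' M2'' →
      LMerge (.amI V M1 M2) (.amI V M1' M2') (.amI V M1'' M2'')

/-- The branching relation on local programs: `L ⊒ L'` iff `L ⊔ L' = L`. -/
def LGeq (L L' : LTerm) : Prop := LMerge L L' L

/-- The branching relation extended pointwise to networks. -/
def NetGeq (N N' : Network) : Prop :=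
  ∀ p, (N p = none ∧ N' p = none) ∨
    ∃ L L', N p = some L ∧ N' p = some L' ∧ LGeq L L'

end ChorLam
namespace ChorLam

/-! ### Endpoint projection -/

/-- Projection of choreographic types: `⟦T⟧_p = S`.
Defined relationally, following the paper's rules; kind information about
type variables is looked up in the environment Γ. -/
inductive ProjT : Ctx → CType → Proc → LType → Prop
  | var_bot :
      CtxEntry.kd (.var X) (.without K ρ) ∈ Γ →
      K ≠ .proc →
      PV.proc p ∈ ρ →
      ProjT Γ (.var X) p .bot
  | var :
      (∀ K ρ, CtxEntry.kd (.var X) (.without K ρ) ∈ Γ → K = .proc ∨ PV.proc p ∉ ρ) →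
      ProjT Γ (.var X) p (.var X)
  | proc : ProjT Γ (.proc q) p (.proc q)
  | unit_self : ProjT Γ (.unit (.proc p)) p .unit
  | unit_other :
      V ≠ .proc p →
      ProjT Γ (.unit V) p .bot
  | int_self : ProjT Γ (.int (.proc p)) p .int
  | int_other :
      V ≠ .proc p →
      ProjT Γ (.int V) p .bot
  | prod_bot :
      ProjT Γ T1 p .bot → ProjT Γ T2 p .bot →
      ProjT Γ (.prod T1 T2) p .bot
  | prod :
      ProjT Γ T1 p S1 → ProjT Γ T2 p S2 →
      ¬(S1 = .bot ∧ S2 = .bot) →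
      ProjT Γ (.prod T1 T2) p (.prod S1 S2)
  | sum_bot :
      ProjT Γ T1 p .bot → ProjT Γ T2 p .bot →
      ProjT Γ (.sum T1 T2) p .bot
  | sum :
      ProjT Γ T1 p S1 → ProjT Γ T2 p S2 →
      ¬(S1 = .bot ∧ S2 = .bot) →
      ProjT Γ (.sum T1 T2) p (.sum S1 S2)
  | arrow :
      ProjT Γ T1 p S1 → ProjT Γ T2 p S2 →
      (PV.proc p ∈ ρ ∨ (S1 ≠ .bot ∧ S2 ≠ .bot)) →
      ProjT Γ (.arrow T1 ρ T2) p (.arrow S1 S2)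
  | arrow_bot :
      ProjT Γ T1 p S1 → ProjT Γ T2 p S2 →
      PV.proc p ∉ ρ →
      (S1 = .bot ∨ S2 = .bot) →
      ProjT Γ (.arrow T1 ρ T2) p .bot
  | all_bot :
      ¬ K.isProcKind →
      K = .without K' ρ →
      PV.proc p ∈ ρ →
      ProjT (CtxEntry.kd (.var X) K :: Γ) T p .bot →
      ProjT Γ (.all X K T) p .bot
  | all_proc :
      K.isProcKind →
      ProjT Γ (CType.subst X (.proc p) T) p S1 →
      ProjT (CtxEntry.kd (.var X) K :: Γ) T p S2 →
      ProjT Γ (.all X K T) p (.all X (.amI (.var X) S1 S2))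
  | all :
      ¬ K.isProcKind →
      ProjT (CtxEntry.kd (.var X) K :: Γ) T p S →
      ¬(S = .bot ∧ ∃ K' ρ, K = .without K' ρ ∧ PV.proc p ∈ ρ) →
      ProjT Γ (.all X K T) p (.all X S)
  | lam_bot :
      ¬ K.isProcKind →
      K = .without K' ρ →
      PV.proc p ∈ ρ →
      ProjT (CtxEntry.kd (.var X) K :: Γ) T p .bot →
      ProjT Γ (.lam X K T) p .bot
  | lam_proc :
      K.isProcKind →
      ProjT Γ (CType.subst X (.proc p) T) p S1 →
      ProjT (CtxEntry.kd (.var X) K :: Γ) T p S2 →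
      ProjT Γ (.lam X K T) p (.lam X (.amI (.var X) S1 S2))
  | lam :
      ¬ K.isProcKind →
      ProjT (CtxEntry.kd (.var X) K :: Γ) T p S →
      ¬(S = .bot ∧ ∃ K' ρ, K = .without K' ρ ∧ PV.proc p ∈ ρ) →
      ProjT Γ (.lam X K T) p (.lam X S)
  | app_bot :
      ProjT Γ T1 p .bot → ProjT Γ T2 p .bot →
      ProjT Γ (.app T1 T2) p .bot
  | app_l :
      ProjT Γ T2 p .bot →
      (∃ Θ K ρ, Kinding Θ Γ T2 (.without K ρ) ∧ PV.proc p ∈ ρ) →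
      ProjT Γ T1 p S1 →
      S1 ≠ .bot →
      ProjT Γ (.app T1 T2) p S1
  | app_r :
      ProjT Γ T1 p .bot →
      ProjT Γ T2 p S2 →
      S2 ≠ .bot →
      ProjT Γ (.app T1 T2) p S2
  | app :
      ProjT Γ T1 p S1 → ProjT Γ T2 p S2 →
      S1 ≠ .bot →
      ¬(S2 = .bot ∧ ∃ Θ K ρ, Kinding Θ Γ T2 (.without K ρ) ∧ PV.proc p ∈ ρ) →
      ProjT Γ (.app T1 T2) p (.app S1 S2)

/-- Endpoint projection of choreographies: `⟦M⟧_p = L`.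
Defined relationally over (implicit) typing derivations, following the
paper's projection rules. -/
inductive Proj : Set PV → Ctx → Chor → Proc → LTerm → Prop
  | var_bot :
      CtxEntry.tv x T ∈ Γ →
      ProjT Γ T p .bot →
      Proj Θ Γ (.var x) p .bot
  | var :
      CtxEntry.tv x T ∈ Γ →
      ProjT Γ T p S →
      S ≠ .bot →
      Proj Θ Γ (.var x) p (.var x)
  | fn : Proj Θ Γ (.fn f) p (.fn f)
  | unit_self :
      ProjT Γ V p (.proc p) →
      Proj Θ Γ (.unit V) p .unit
  | unit_other :
      ProjT Γ V p S →
      S ≠ .proc p →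
      Proj Θ Γ (.unit V) p .bot
  | int_self :
      ProjT Γ V p (.proc p) →
      Proj Θ Γ (.int n V) p (.int n)
  | int_other :
      ProjT Γ V p S →
      S ≠ .proc p →
      Proj Θ Γ (.int n V) p .bot
  | lam_bot :
      Proj Θ (CtxEntry.tv x T :: Γ) M p .bot →
      ProjT Γ T p .bot →
      Proj Θ Γ (.lam x T M) p .bot
  | lam :
      Proj Θ (CtxEntry.tv x T :: Γ) M p L →
      ProjT Γ T p S →
      ¬(L = .bot ∧ S = .bot) →
      Proj Θ Γ (.lam x T M) p (.lam x S L)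
  | app_bot :
      Proj Θ Γ M p .bot → Proj Θ Γ N p .bot →
      Proj Θ Γ (.app M N) p .bot
  | app :
      Typing Θ Γ M TM →
      Proj Θ Γ M p LM → Proj Θ Γ N p LN →
      (p ∈ TM.roles ∨ (LM ≠ .bot ∧ LN ≠ .bot)) →
      Proj Θ Γ (.app M N) p (.app LM LN)
  | app_l :
      Typing Θ Γ M TM →
      p ∉ TM.roles →
      Proj Θ Γ N p .bot →
      Proj Θ Γ M p LM →
      LM ≠ .bot →
      Proj Θ Γ (.app M N) p LM
  | app_r :
      Typing Θ Γ M TM →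
      p ∉ TM.roles →
      Proj Θ Γ M p .bot →
      Proj Θ Γ N p LN →
      LN ≠ .bot →
      Proj Θ Γ (.app M N) p LN
  | tlam_proc :
      K.isProcKind →
      Proj (thetaExt Θ X K) Γ (Chor.substT X (.proc p) M) p L1 →
      Proj (thetaExt Θ X K) (CtxEntry.kd (.var X) K :: Γ) M p L2 →
      Proj Θ Γ (.tlam X K M) p (.tlam X (.amI (.var X) L1 L2))
  | tlam_bot :
      ¬ K.isProcKind →
      K = .without K' ρ →
      PV.proc p ∈ ρ →
      Proj Θ (CtxEntry.kd (.var X) K :: Γ) M p .bot →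
      Proj Θ Γ (.tlam X K M) p .bot
  | tlam :
      ¬ K.isProcKind →
      Proj Θ (CtxEntry.kd (.var X) K :: Γ) M p L →
      ¬(L = .bot ∧ ∃ K' ρ, K = .without K' ρ ∧ PV.proc p ∈ ρ) →
      Proj Θ Γ (.tlam X K M) p (.tlam X L)
  | tapp_bot :
      Proj Θ Γ M p .bot →
      ProjT Γ T p .bot →
      Proj Θ Γ (.tapp M T) p .bot
  | tapp_m :
      ProjT Γ T p .bot →
      Kinding Θ Γ T (.without K ρ) →
      PV.proc p ∈ ρ →
      Proj Θ Γ M p LM →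
      LM ≠ .bot →
      Proj Θ Γ (.tapp M T) p LM
  | tapp_t :
      Proj Θ Γ M p .bot →
      ProjT Γ T p S →
      S ≠ .bot →
      Proj Θ Γ (.tapp M T) p (.tapp .bot S)
  | tapp :
      Proj Θ Γ M p LM →
      ProjT Γ T p S →
      LM ≠ .bot →
      ¬(S = .bot ∧ ∃ K ρ, Kinding Θ Γ T (.without K ρ) ∧ PV.proc p ∈ ρ) →
      Proj Θ Γ (.tapp M T) p (.tapp LM S)
  | inl_bot :
      Proj Θ Γ M p .bot →
      Kinding Θ Γ T (.without K ρ) →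
      Proj Θ Γ (.inl T M) p .bot
  | inl_erase :
      Typing Θ Γ M TM →
      ProjT Γ TM p .bot →
      Proj Θ Γ M p LM →
      Proj Θ Γ (.inl T M) p LM
  | inl :
      Typing Θ Γ M TM →
      ProjT Γ TM p SM →
      SM ≠ .bot →
      Proj Θ Γ M p LM →
      ProjT Γ T p S →
      Proj Θ Γ (.inl T M) p (.inl S LM)
  | inr_bot :
      Proj Θ Γ M p .bot →
      Kinding Θ Γ T (.without K ρ) →
      Proj Θ Γ (.inr T M) p .bot
  | inr_erase :
      Typing Θ Γ M TM →
      ProjT Γ TM p .bot →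
      Proj Θ Γ M p LM →
      Proj Θ Γ (.inr T M) p LM
  | inr :
      Typing Θ Γ M TM →
      ProjT Γ TM p SM →
      SM ≠ .bot →
      Proj Θ Γ M p LM →
      ProjT Γ T p S →
      Proj Θ Γ (.inr T M) p (.inr S LM)
  | case_roles :
      Typing Θ Γ M (.sum T1 T2) →
      p ∈ (CType.sum T1 T2).roles →
      Proj Θ Γ M p LM →
      Proj Θ (CtxEntry.tv x T1 :: Γ) N1 p L1 →
      Proj Θ (CtxEntry.tv y T2 :: Γ) N2 p L2 →
      Proj Θ Γ (.case M x N1 y N2) p (.case LM x L1 y L2)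
  | case_bot :
      Typing Θ Γ M (.sum T1 T2) →
      p ∉ (CType.sum T1 T2).roles →
      Proj Θ Γ M p .bot →
      Proj Θ (CtxEntry.tv x T1 :: Γ) N1 p .bot →
      Proj Θ (CtxEntry.tv y T2 :: Γ) N2 p .bot →
      Proj Θ Γ (.case M x N1 y N2) p .bot
  | case_m :
      Typing Θ Γ M (.sum T1 T2) →
      p ∉ (CType.sum T1 T2).roles →
      Proj Θ Γ M p LM →
      LM ≠ .bot →
      Proj Θ (CtxEntry.tv x T1 :: Γ) N1 p .bot →
      Proj Θ (CtxEntry.tv y T2 :: Γ) N2 p .bot →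
      Proj Θ Γ (.case M x N1 y N2) p LM
  | case_merge :
      Typing Θ Γ M (.sum T1 T2) →
      p ∉ (CType.sum T1 T2).roles →
      Proj Θ Γ M p .bot →
      Proj Θ (CtxEntry.tv x T1 :: Γ) N1 p L1 →
      Proj Θ (CtxEntry.tv y T2 :: Γ) N2 p L2 →
      ¬(L1 = .bot ∧ L2 = .bot) →
      LMerge L1 L2 L →
      Proj Θ Γ (.case M x N1 y N2) p L
  | case_app :
      Typing Θ Γ M (.sum T1 T2) →
      p ∉ (CType.sum T1 T2).roles →
      Proj Θ Γ M p LM →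
      LM ≠ .bot →
      Proj Θ (CtxEntry.tv x T1 :: Γ) N1 p L1 →
      Proj Θ (CtxEntry.tv y T2 :: Γ) N2 p L2 →
      ¬(L1 = .bot ∧ L2 = .bot) →
      LMerge L1 L2 L →
      Proj Θ Γ (.case M x N1 y N2) p (.app (.lam z .bot L) LM)
  | pair_bot :
      Proj Θ Γ M1 p .bot → Proj Θ Γ M2 p .bot →
      Proj Θ Γ (.pair M1 M2) p .bot
  | pair :
      Proj Θ Γ M1 p L1 → Proj Θ Γ M2 p L2 →
      ¬(L1 = .bot ∧ L2 = .bot) →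
      Proj Θ Γ (.pair M1 M2) p (.pair L1 L2)
  | fst_bot :
      Proj Θ Γ M p .bot →
      Proj Θ Γ (.fst M) p .bot
  | fst_erase :
      Typing Θ Γ M TM →
      ProjT Γ TM p .bot →
      Proj Θ Γ M p LM →
      LM ≠ .bot →
      Proj Θ Γ (.fst M) p LM
  | fst :
      Typing Θ Γ M TM →
      ProjT Γ TM p SM →
      SM ≠ .bot →
      Proj Θ Γ M p LM →
      LM ≠ .bot →
      Proj Θ Γ (.fst M) p (.fst LM)
  | snd_bot :
      Proj Θ Γ M p .bot →
      Proj Θ Γ (.snd M) p .bot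
  | snd_erase :
      Typing Θ Γ M TM →
      ProjT Γ TM p .bot →
      Proj Θ Γ M p LM →
      LM ≠ .bot →
      Proj Θ Γ (.snd M) p LM
  | snd :
      Typing Θ Γ M TM →
      ProjT Γ TM p SM →
      SM ≠ .bot →
      Proj Θ Γ M p LM →
      LM ≠ .bot →
      Proj Θ Γ (.snd M) p (.snd LM)
  | sel_choice :
      V1 = .proc p →
      V2 ≠ .proc p →
      ProjT Γ V2 p W2 →
      Proj Θ Γ M p L →
      Proj Θ Γ (.select V1 V2 l M) p (.choice W2 l L)
  | sel_offer :
      V2 = .proc p →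
      V1 ≠ .proc p →
      ProjT Γ V1 p W1 →
      Proj Θ Γ M p L →
      Proj Θ Γ (.select V1 V2 l M) p (.offer W1 (fun l' => l' = l) (fun _ => L))
  | sel_skip :
      ¬(V1 = .proc p ∧ V2 ≠ .proc p) →
      ¬(V2 = .proc p ∧ V1 ≠ .proc p) →
      Proj Θ Γ M p L →
      Proj Θ Γ (.select V1 V2 l M) p L
  | com_self :
      ProjT Γ (.app T (.proc p)) p S →
      Proj Θ Γ (.com T (.proc p) (.proc p)) p (.lam x S (.var x))
  | com_send :
      q2 ≠ p →
      Proj Θ Γ (.com T (.proc p) (.proc q2)) p (.send (.proc q2))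
  | com_recv :
      q1 ≠ p →
      Proj Θ Γ (.com T (.proc q1) (.proc p)) p (.recv (.proc q1))
  | com_sub :
      V1 ≠ .proc p →
      V2 ≠ .proc p →
      ProjT Γ T p S →
      S ≠ .bot →
      ProjT Γ V1 p W1 →
      ProjT Γ V2 p W2 →
      Proj Θ Γ (.com T V1 V2) p (.sub W1 W2)
  | com_bot :
      V1 ≠ .proc p →
      V2 ≠ .proc p →
      ProjT Γ T p .bot →
      Proj Θ Γ (.com T V1 V2) p .bot

/-- The projected network `⟦M⟧ = ∏_{p ∈ roles(M)} p[⟦M⟧_p]`. -/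
def ProjNet (Θ : Set PV) (Γ : Ctx) (M : Chor) (N : Network) : Prop :=
  ∀ p : Proc,
    (p ∈ M.procs → ∃ L, Proj Θ Γ M p L ∧ N p = some L) ∧
    (p ∉ M.procs → N p = none)

/-- Pointwise projection of a set of function definitions (onto an
arbitrarily chosen process name). -/
def ProjDefs (Θ : Set PV) (Γ : Ctx) (D : FName → Option Chor)
    (D' : FName → Option LTerm) : Prop :=
  ∃ p : Proc, ∀ f,
    (∀ M, D f = some M → ∃ L, Proj Θ Γ M p L ∧ D' f = some L) ∧
    (D f = none → D' f = none)

/-- The canonical identification of a choreographic type with a local type,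
erasing locations, intermediary annotations and kinds. -/
def CType.toLType : CType → LType
  | .var X => .var X
  | .proc p => .proc p
  | .unit _ => .unit
  | .int _ => .int
  | .arrow T1 _ T2 => .arrow T1.toLType T2.toLType
  | .sum T1 T2 => .sum T1.toLType T2.toLType
  | .prod T1 T2 => .prod T1.toLType T2.toLType
  | .all X _ T => .all X T.toLType
  | .lam X _ T => .lam X T.toLType
  | .app T1 T2 => .app T1.toLType T2.toLType

end ChorLam

namespace ChorLam

theorem Network.restrict_apply_of_notMem (N : Network) {ρ : Finset Proc} {p : Proc}
    (hp : p ∉ ρ) : N.restrict ρ p = N p :=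
  if_neg hp

theorem Network.restrict_update_of_notMem (N : Network) {ρ : Finset Proc} {p : Proc}
    (hp : p ∉ ρ) (o : Option LTerm) :
    Network.restrict (Function.update N p o) ρ = Function.update (N.restrict ρ) p o := by
  funext r
  by_cases hr : r = p
  · subst hr
    simp [Network.restrict, hp]
  · simp [Network.restrict, hr]

end ChorLam

open ChorLam in
/-- Removing processes disjoint from a transition's label preserves the
transition: if `N →^{τ_P}_{D'} N'` and `P ∩ ρ = ∅` then
`N ∖ ρ →^{τ_P}_{D'} N' ∖ ρ`. -/
theorem netstep_restrict (ρ : Finset Proc) (D' : FName → Option LTerm)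
    (N N' : Network) (P : Finset Proc) (h : NetStep D' N P N')
    (hdisj : P ∩ ρ = ∅) :
    NetStep D' (N.restrict ρ) P (N'.restrict ρ) := by
  have hnot : ∀ r ∈ P, r ∉ ρ :=
    fun r hr => Finset.disjoint_left.mp (Finset.disjoint_iff_inter_eq_empty.mpr hdisj) hr
  cases h with
  | ncom hne hNq hNp hV hV' hsend hrecv =>
    have hq := hnot _ (Finset.mem_insert_self _ _)
    have hp := hnot _ (Finset.mem_insert_of_mem (Finset.mem_singleton_self _))
    rw [Network.restrict_update_of_notMem _ hp, Network.restrict_update_of_notMem _ hq]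
    exact .ncom hne ((N.restrict_apply_of_notMem hq).trans hNq)
      ((N.restrict_apply_of_notMem hp).trans hNp) hV hV' hsend hrecv
  | nsel hne hNq hNp hchoice hoffer =>
    have hq := hnot _ (Finset.mem_insert_self _ _)
    have hp := hnot _ (Finset.mem_insert_of_mem (Finset.mem_singleton_self _))
    rw [Network.restrict_update_of_notMem _ hp, Network.restrict_update_of_notMem _ hq]
    exact .nsel hne ((N.restrict_apply_of_notMem hq).trans hNq)
      ((N.restrict_apply_of_notMem hp).trans hNp) hchoice hoffer
  | nproam hNp hstep =>
    have hp := hnot _ (Finset.mem_singleton_self _)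
    rw [Network.restrict_update_of_notMem _ hp]
    exact .nproam ((N.restrict_apply_of_notMem hp).trans hNp) hstep
  | npro hNp hstep =>
    have hp := hnot _ (Finset.mem_singleton_self _)
    rw [Network.restrict_update_of_notMem _ hp]
    exact .npro ((N.restrict_apply_of_notMem hp).trans hNp) hstep
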